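/- Let L ≥ 4 be even, and let A, B, C be pairwise disjoint nonempty contiguous arcs of ZMod L whose union is ZMod L, with |A| ≥ 2. Then there is no nonzero positive semidefinite operator ρ on the chain Hilbert space such that (i) ρ is strongly symmetric under U_CZX, i.e., U_CZX ρ = λ ρ for some λ ∈ ℂ, and (ii) ρ is tripartite separable with respect to {A, B, C}: ρ = Σ_i p_i |ψ_i⟩⟨ψ_i| with finitely many terms, p_i > 0, and each ψ_i separable with respect to the partition {A, B, C}. -/

import Mathlib

open Matrix ComplexOrder

/-- The rank-one operator `|ψ⟩⟨ψ| : v ↦ ⟨ψ, v⟩ ψ`, as a matrix. -/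
noncomputable def outer {ι : Type*} [Fintype ι] (ψ : ι → ℂ) : Matrix ι ι ℂ :=
  Matrix.of fun i j => ψ i * (starRingEnd ℂ) (ψ j)

/-- The CZX operator on a periodic chain of `L` qubits:
`U_CZX |b⟩ = (−1)^{Σ_i b_i b_{i+1}} |¬b⟩`. -/
noncomputable def czxMatrix (L : ℕ) [NeZero L] :
    Matrix (ZMod L → Bool) (ZMod L → Bool) ℂ :=
  Matrix.of fun b b' =>
    if b = (fun i => ! b' i) then
      ∏ i : ZMod L, (if b' i && b' (i + 1) then (-1 : ℂ) else 1)
    else 0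

/-- A contiguous arc `{j, j+1, …, j+m−1}` in `ZMod L`. -/
def IsArc {L : ℕ} (A : Set (ZMod L)) : Prop :=
  ∃ (j : ZMod L) (m : ℕ), A = {x | ∃ k, k < m ∧ x = j + (k : ZMod L)}

/-- A vector of the chain Hilbert space separable with respect to the
tripartition `{A, B, C}`: `ψ(b) = f(b|_A) g(b|_B) h(b|_C)`. -/
def SepVec3 {L : ℕ} (A B C : Set (ZMod L)) (ψ : (ZMod L → Bool) → ℂ) : Prop :=
  ∃ (f : (A → Bool) → ℂ) (g : (B → Bool) → ℂ) (h : (C → Bool) → ℂ),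
    ∀ b, ψ b = f (fun x => b x.1) * g (fun x => b x.1) * h (fun x => b x.1)

/-- A nonempty proper subset of `ZMod L` has a point whose successor is outside. -/
lemma exists_mem_add_one_notMem {L : ℕ} [NeZero L] {S : Set (ZMod L)} (hne : S.Nonempty)
    (huniv : S ≠ Set.univ) : ∃ i ∈ S, i + 1 ∉ S := by
  by_contra! hcl
  obtain ⟨x, hx⟩ := hne
  refine huniv (Set.eq_univ_of_forall fun y => ?_)
  have key : ∀ k : ℕ, x + (k : ZMod L) ∈ S := by
    intro k
    induction k with
    | zero => simpa using hx
    | succ k ih =>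
      have := hcl _ ih
      rwa [add_assoc, ← Nat.cast_succ] at this
  have := key (y - x).val
  rwa [ZMod.natCast_zmod_val, add_sub_cancel] at this

/-- A contiguous arc has at most one point whose successor is outside. -/
lemma IsArc.exit_unique {L : ℕ} {A : Set (ZMod L)} (hA : IsArc A) {i i' : ZMod L}
    (hi : i ∈ A) (hi1 : i + 1 ∉ A) (hi' : i' ∈ A) (hi1' : i' + 1 ∉ A) : i = i' := by
  obtain ⟨j, m, rfl⟩ := hA
  obtain ⟨k, hk, rfl⟩ := hi
  obtain ⟨k', hk', rfl⟩ := hi'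
  have hkm : ¬ k + 1 < m := fun h => hi1 ⟨k + 1, h, by push_cast; ring⟩
  have hkm' : ¬ k' + 1 < m := fun h => hi1' ⟨k' + 1, h, by push_cast; ring⟩
  have : k = k' := by omega
  rw [this]

/-- The sign `(-1)^{Σ_i b_i b_{i+1}}`. -/
noncomputable def czSign {L : ℕ} [NeZero L] (b : ZMod L → Bool) : ℂ :=
  ∏ i : ZMod L, (if b i && b (i + 1) then (-1 : ℂ) else 1)

lemma czSign_mul_self {L : ℕ} [NeZero L] (b : ZMod L → Bool) : czSign b * czSign b = 1 := by
  rw [czSign, ← Finset.prod_mul_distrib]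
  refine Finset.prod_eq_one fun i _ => ?_
  split_ifs <;> norm_num

lemma czxMatrix_mulVec_not {L : ℕ} [NeZero L] (ψ : (ZMod L → Bool) → ℂ) (b : ZMod L → Bool) :
    (czxMatrix L *ᵥ ψ) (fun i => ! b i) = czSign b * ψ b := by
  rw [Matrix.mulVec, dotProduct, Finset.sum_eq_single b]
  · simp [czxMatrix, czSign]
  · intro b' _ hb'
    have : ¬ ((fun i => ! b i) = fun i => ! b' i) := by
      intro h
      refine hb' (funext fun i => ?_)
      have := congrFun h i
      simpa using this.symm
    simp [czxMatrix, this]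
  · simp

open Classical in
/-- The bit string obtained from `b` by complementing the bits in `X`. -/
noncomputable def flipOn {L : ℕ} (X : Set (ZMod L)) (b : ZMod L → Bool) : ZMod L → Bool :=
  fun i => if i ∈ X then ! b i else b i

/-- If `A` and `B` are joined by exactly one edge, the second difference of the CZ sign
under flipping `A` and `B` is `-1`. -/
lemma czSign_flipOn_prod {L : ℕ} [NeZero L] {A B : Set (ZMod L)} (hAB : Disjoint A B)
    {i₀ : ZMod L} (hedge : ∀ i, (i ∈ A ∧ i + 1 ∈ B ∨ i ∈ B ∧ i + 1 ∈ A) ↔ i = i₀)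
    (b : ZMod L → Bool) :
    czSign b * czSign (flipOn (A ∪ B) b) * czSign (flipOn A b) * czSign (flipOn B b) = -1 := by
  classical
  simp only [czSign, ← Finset.prod_mul_distrib]
  rw [← Fintype.prod_ite_eq' i₀ fun _ => (-1 : ℂ)]
  refine Finset.prod_congr rfl fun i _ => ?_
  have h0 : i ∈ A → i ∉ B := fun h h' => Set.disjoint_left.1 hAB h h'
  have h1 : i + 1 ∈ A → i + 1 ∉ B := fun h h' => Set.disjoint_left.1 hAB h h'
  have he := hedge i
  simp only [flipOn, Set.mem_union]
  by_cases ha : i ∈ A <;> by_cases hb : i ∈ B <;> by_cases ha' : i + 1 ∈ A <;>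
    by_cases hb' : i + 1 ∈ B <;> simp only [ha, hb, ha', hb', not_true, not_false_eq_true,
      true_imp_iff, imp_false, and_true, and_false, or_true, or_false,
      true_iff, false_iff, or_self, if_true, if_false] at h0 h1 he ⊢ <;>
    cases b i <;> cases b (i + 1) <;> simp [he]

/-- A tripartite separable eigenvector of the CZX operator vanishes when the first two parts
are joined by exactly one edge. -/
lemma SepVec3.eq_zero_of_unique_edge {L : ℕ} [NeZero L] {A B C : Set (ZMod L)}
    (hAB : Disjoint A B) (hAC : Disjoint A C) (hBC : Disjoint B C)
    {i₀ : ZMod L} (hedge : ∀ i, (i ∈ A ∧ i + 1 ∈ B ∨ i ∈ B ∧ i + 1 ∈ A) ↔ i = i₀)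
    {ψ : (ZMod L → Bool) → ℂ} (hψ : SepVec3 A B C ψ) {lam : ℂ}
    (heig : ∀ b, czSign b * ψ b = lam * ψ (fun i => ! b i)) : ψ = 0 := by
  classical
  obtain ⟨f, g, h, hfgh⟩ := hψ
  funext b
  by_contra hb
  have nA : ∀ x : A, x.1 ∉ B := fun x => Set.disjoint_left.1 hAB x.2
  have nA' : ∀ x : B, x.1 ∉ A := fun x => Set.disjoint_right.1 hAB x.2
  have nC : ∀ x : C, x.1 ∉ A := fun x => Set.disjoint_right.1 hAC x.2
  have nC' : ∀ x : C, x.1 ∉ B := fun x => Set.disjoint_right.1 hBC x.2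
  have e00 := heig b
  have e11 := heig (flipOn (A ∪ B) b)
  have e10 := heig (flipOn A b)
  have e01 := heig (flipOn B b)
  have hprod := czSign_flipOn_prod hAB hedge b
  have q00 := czSign_mul_self b
  have q10 := czSign_mul_self (flipOn A b)
  have q01 := czSign_mul_self (flipOn B b)
  rw [Pi.zero_apply, hfgh] at hb
  generalize czSign b = s00 at *
  generalize czSign (flipOn (A ∪ B) b) = s11 at *
  generalize czSign (flipOn A b) = s10 at *
  generalize czSign (flipOn B b) = s01 at *
  simp only [hfgh, flipOn, Set.mem_union, Subtype.coe_prop, nA, nA', nC, nC', or_false, or_true,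
    or_self, if_true, if_false, Bool.not_not] at e00 e11 e10 e01
  generalize f (fun x => b x) = f0 at *
  generalize g (fun x => b x) = g0 at *
  generalize h (fun x => b x) = h0 at *
  generalize f (fun x => ! b x) = f1 at *
  generalize g (fun x => ! b x) = g1 at *
  generalize h (fun x => ! b x) = h1 at *
  have hs00 : s00 ≠ 0 := left_ne_zero_of_mul (q00.symm ▸ one_ne_zero)
  have hne : lam * (f1 * g1 * h1) ≠ 0 := e00 ▸ mul_ne_zero hs00 hb
  have hss : s00 * s11 = -(s10 * s01) := by
    linear_combination s10 * s01 * hprod - s00 * s11 * q10 * s01 * s01 - s00 * s11 * q01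
  have hz : 2 * (s10 * s01) * (f0 * f1 * g0 * g1 * h0 ^ 2) = 0 := by
    have p1 := congrArg₂ (· * ·) e00 e11
    have p2 := congrArg₂ (· * ·) e10 e01
    linear_combination p2 - p1 + (f0 * f1 * g0 * g1 * h0 ^ 2) * hss
  have hs10 : s10 ≠ 0 := left_ne_zero_of_mul (q10.symm ▸ one_ne_zero)
  have hs01 : s01 ≠ 0 := left_ne_zero_of_mul (q01.symm ▸ one_ne_zero)
  simp_all

/-- If three arcs partition `ZMod L` and the first exits into the second, then the first two
are joined by exactly one edge. -/
lemma edge_iff_of_exit {L : ℕ} [NeZero L] {A B C : Set (ZMod L)} (hA : IsArc A) (hB : IsArc B)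
    (hAne : A.Nonempty) (hCne : C.Nonempty)
    (hAB : Disjoint A B) (hAC : Disjoint A C) (hBC : Disjoint B C)
    (hUnion : A ∪ B ∪ C = Set.univ) {i₀ : ZMod L} (hi₀ : i₀ ∈ A) (hi₀' : i₀ + 1 ∈ B) (i : ZMod L) :
    (i ∈ A ∧ i + 1 ∈ B ∨ i ∈ B ∧ i + 1 ∈ A) ↔ i = i₀ := by
  have dAB : ∀ x ∈ A, x ∉ B := fun x hx => Set.disjoint_left.1 hAB hx
  have dAC : ∀ x ∈ A, x ∉ C := fun x hx => Set.disjoint_left.1 hAC hx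
  have dBC : ∀ x ∈ B, x ∉ C := fun x hx => Set.disjoint_left.1 hBC hx
  have hu : ∀ x, x ∈ A ∨ x ∈ B ∨ x ∈ C := fun x => by
    have : x ∈ A ∪ B ∪ C := hUnion ▸ Set.mem_univ x
    simpa [or_assoc] using this
  have uA : ∀ x ∈ A, x + 1 ∉ A → x = i₀ := fun x hx hx' =>
    hA.exit_unique hx hx' hi₀ fun h => dAB _ h hi₀'
  obtain ⟨c, hc, hc'⟩ : ∃ c ∉ C, c + 1 ∈ C := by
    have hne : (Cᶜ).Nonempty := hAne.mono fun x hx => dAC x hx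
    have hun : Cᶜ ≠ Set.univ := by simpa using hCne.ne_empty
    obtain ⟨c, hc, hc'⟩ := exists_mem_add_one_notMem hne hun
    exact ⟨c, hc, not_not.1 hc'⟩
  have hcB : c ∈ B := by
    rcases hu c with h | h | h
    · have := uA c h fun h' => dAC _ h' hc'
      subst this
      exact (dBC _ hi₀' hc').elim
    · exact h
    · exact (hc h).elim
  constructor
  · rintro (⟨h, h'⟩ | ⟨h, h'⟩)
    · exact uA i h fun h'' => dAB _ h'' h'
    · have := hB.exit_unique h (dAB _ h') hcB fun h'' => dBC _ h'' hc'
      subst this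
      exact (dAC _ h' hc').elim
  · rintro rfl
    exact Or.inl ⟨hi₀, hi₀'⟩

lemma SepVec3.swap {L : ℕ} {A B C : Set (ZMod L)} {ψ : (ZMod L → Bool) → ℂ}
    (hψ : SepVec3 A B C ψ) : SepVec3 A C B ψ := by
  obtain ⟨f, g, h, hfgh⟩ := hψ
  exact ⟨f, h, g, fun b => by rw [hfgh]; ring⟩

/-- If `M` annihilates a positive combination of rank-one operators, it annihilates each of the
vectors. -/
lemma mulVec_eq_zero_of_mul_sum_outer_eq_zero {ι κ : Type*} [Fintype ι] [Fintype κ]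
    {M : Matrix ι ι ℂ} {p : κ → ℝ} (hp : ∀ i, 0 < p i) {ψ : κ → ι → ℂ}
    (hM : M * ∑ i, (p i : ℂ) • outer (ψ i) = 0) (i : κ) : M *ᵥ ψ i = 0 := by
  have houter : ∀ v : ι → ℂ, outer v = vecMulVec v (star v) := fun v => rfl
  have h : ∑ i, (p i : ℂ) • vecMulVec (M *ᵥ ψ i) (star (M *ᵥ ψ i)) = 0 := by
    have := congrArg (· * Mᴴ) hM
    simpa only [zero_mul, Matrix.mul_sum, Matrix.sum_mul, houter, Matrix.mul_smul,
      Matrix.smul_mul, mul_vecMulVec, vecMulVec_mul, ← star_mulVec] using this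
  funext k
  have hk := congrFun (congrFun h k) k
  simp only [Matrix.sum_apply, Matrix.smul_apply, vecMulVec_apply, Pi.star_apply, smul_eq_mul,
    RCLike.star_def, Complex.mul_conj, Matrix.zero_apply] at hk
  norm_cast at hk
  rw [Finset.sum_eq_zero_iff_of_nonneg
    fun j _ => mul_nonneg (hp j).le (Complex.normSq_nonneg _)] at hk
  have := (mul_eq_zero.1 (hk i (Finset.mem_univ i))).resolve_left (hp i).ne'
  simpa using this

/-- No nonzero positive semidefinite operator that is strongly symmetric under the
anomalous CZX symmetry is tripartite separable with respect to a partition of the ring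
into three contiguous arcs (with `|A| ≥ 2`). -/
theorem no_tripartite_separable_strongly_symmetric_czx_state
    (L : ℕ) [NeZero L] (hL4 : 4 ≤ L) (hLe : Even L)
    (A B C : Set (ZMod L)) (hA : IsArc A) (hB : IsArc B) (hC : IsArc C)
    (hAne : A.Nonempty) (hBne : B.Nonempty) (hCne : C.Nonempty)
    (hAB : Disjoint A B) (hAC : Disjoint A C) (hBC : Disjoint B C)
    (hUnion : A ∪ B ∪ C = Set.univ) (hA2 : 2 ≤ A.ncard)
    (ρ : Matrix (ZMod L → Bool) (ZMod L → Bool) ℂ)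
    (hρne : ρ ≠ 0) (hpsd : ρ.PosSemidef)
    (lam : ℂ) (hsym : czxMatrix L * ρ = lam • ρ)
    (n : ℕ) (p : Fin n → ℝ) (hp : ∀ i, 0 < p i)
    (ψ : Fin n → (ZMod L → Bool) → ℂ)
    (hsep : ∀ i, SepVec3 A B C (ψ i))
    (hdecomp : ρ = ∑ i, (p i : ℂ) • outer (ψ i)) : False := by
  have heig : ∀ i b, czSign b * ψ i b = lam * ψ i (fun j => ! b j) := by
    intro i b
    have hM : (czxMatrix L - lam • (1 : Matrix _ _ ℂ)) * ∑ i, (p i : ℂ) • outer (ψ i) = 0 := by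
      rw [← hdecomp, sub_mul, hsym, smul_mul_assoc, one_mul, sub_self]
    have h := congrFun (mulVec_eq_zero_of_mul_sum_outer_eq_zero hp hM i) (fun j => ! b j)
    rw [sub_mulVec, smul_mulVec, one_mulVec, Pi.sub_apply, czxMatrix_mulVec_not] at h
    simpa [sub_eq_zero] using h
  have hAuniv : A ≠ Set.univ := by
    rintro rfl
    obtain ⟨x, hx⟩ := hBne
    exact Set.disjoint_left.1 hAB (Set.mem_univ x) hx
  obtain ⟨i₀, hi₀, hi₀'⟩ := exists_mem_add_one_notMem hAne hAuniv
  have hzero : ∀ i, ψ i = 0 := by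
    intro i
    have hmem : i₀ + 1 ∈ A ∪ B ∪ C := hUnion ▸ Set.mem_univ _
    rcases hmem with (h | h) | h
    · exact (hi₀' h).elim
    · exact (hsep i).eq_zero_of_unique_edge hAB hAC hBC
        (edge_iff_of_exit hA hB hAne hCne hAB hAC hBC hUnion hi₀ h) (heig i)
    · exact (hsep i).swap.eq_zero_of_unique_edge hAC hAB hBC.symm
        (edge_iff_of_exit hA hC hAne hBne hAC hAB hBC.symm
          (by rw [Set.union_right_comm, hUnion]) hi₀ h) (heig i)
  refine hρne ?_
  rw [hdecomp]
  refine Finset.sum_eq_zero fun i _ => ?_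
  ext k l
  simp [outer, hzero i]
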